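/- (Theorem 3, periodic-orbit part, concrete parameters.) Let a = −1, b = 1/4, μ = 15, λ = 3/10, so that A = 4 + 2π, and take k₋ = −11, k₊ = 11. Then 2A ≤ k₊ − k₋ = 22, and for every integer Δ ≥ 1 and every γ with (−11 + 4 + 2π)(1 − (7/10)^Δ) ≤ γ ≤ (11 − 4 − 2π)(1 − (7/10)^Δ), the map F(x) = f^Δ(x) + γ has a fixed point x* ∈ [−11, 11]; consequently the impulsed orbit starting from x₁ = x* is Δ-periodic: x_{n+Δ} = x_n for all n ≥ 1. -/

import Mathlib

/-- If `f` stays within `(1 - q) * A` of the linear map `y ↦ q * y`, then its `n`-th iterate stays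
within `A * (1 - q ^ n)` of `y ↦ q ^ n * y`. -/
theorem abs_iterate_sub_pow_mul_le {f : ℝ → ℝ} {q A : ℝ} (hq : 0 ≤ q)
    (h : ∀ y, |f y - q * y| ≤ (1 - q) * A) (n : ℕ) (y : ℝ) :
    |f^[n] y - q ^ n * y| ≤ A * (1 - q ^ n) := by
  induction n with
  | zero => simp
  | succ n ih =>
    rw [Function.iterate_succ_apply']
    calc |f (f^[n] y) - q ^ (n + 1) * y|
        = |(f (f^[n] y) - q * f^[n] y) + q * (f^[n] y - q ^ n * y)| := by
          congr 1; ring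
      _ ≤ |f (f^[n] y) - q * f^[n] y| + q * |f^[n] y - q ^ n * y| := by
          simpa only [abs_mul, abs_of_nonneg hq] using
            abs_add_le (f (f^[n] y) - q * f^[n] y) (q * (f^[n] y - q ^ n * y))
      _ ≤ (1 - q) * A + q * (A * (1 - q ^ n)) := by
          gcongr
          exact h _
      _ = A * (1 - q ^ (n + 1)) := by ring

/-- An orbit that is impulsed by `γ` every `Δ` steps and starts at a fixed point of the composed
map `y ↦ f^[Δ] y + γ` is `Δ`-periodic. -/
theorem impulsed_orbit_periodic {f : ℝ → ℝ} {γ : ℝ} {Δ : ℕ} (hΔ : 1 ≤ Δ) {x : ℕ → ℝ}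
    (hfix : f^[Δ] (x 1) + γ = x 1)
    (hx : ∀ n : ℕ, 1 ≤ n → x (n + 1) = if Δ ∣ n then f (x n) + γ else f (x n)) :
    ∀ n : ℕ, 1 ≤ n → x (n + Δ) = x n := by
  have free : ∀ j : ℕ, j < Δ → x (j + 1) = f^[j] (x 1) := by
    intro j
    induction j with
    | zero => simp
    | succ j ih =>
      intro hj
      rw [hx (j + 1) (by lia), if_neg (Nat.not_dvd_of_pos_of_lt (by lia) hj), ih (by lia),
        Function.iterate_succ_apply']
  have start : x (1 + Δ) = x 1 := by
    obtain ⟨d, rfl⟩ : ∃ d, Δ = d + 1 := ⟨Δ - 1, by lia⟩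
    rw [add_comm, hx (d + 1) hΔ, if_pos dvd_rfl, free d (by lia),
      ← Function.iterate_succ_apply' f d, hfix]
  intro n hn
  induction n, hn using Nat.le_induction with
  | base => exact start
  | succ n hn ih =>
    rw [add_right_comm, hx (n + Δ) (by lia), hx n hn, ih]
    simp only [Nat.dvd_add_self_right]


/-- Theorem 3, periodic-orbit part, concrete parameters
`a = −1, b = 1/4, μ = 15, λ = 3/10`, so `A = 4 + 2π`, with `k₋ = −11`, `k₊ = 11`:
`2A ≤ 22`, and for every `Δ ≥ 1` and every `γ` in the indicated window, `F` has a fixed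
point `x* ∈ [−11, 11]`, and the impulsed orbit starting from `x*` is `Δ`-periodic. -/
theorem concrete_periodic_orbit
    (γ : ℝ)
    (f : ℝ → ℝ)
    (hf : ∀ y : ℝ, f y = (7 / 10) * y - 6 / 5 - (6 / 5) * Real.arctan (15 * y))
    (Δ : ℕ) (hΔ : 1 ≤ Δ)
    (F : ℝ → ℝ) (hF : ∀ y : ℝ, F y = f^[Δ] y + γ)
    (hγ₁ : (-11 + 4 + 2 * Real.pi) * (1 - (7 / 10) ^ Δ) ≤ γ)
    (hγ₂ : γ ≤ (11 - 4 - 2 * Real.pi) * (1 - (7 / 10) ^ Δ)) :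
    2 * (4 + 2 * Real.pi) ≤ 22 ∧
      ∃ xs ∈ Set.Icc (-11 : ℝ) 11, F xs = xs ∧
        ∀ x : ℕ → ℝ, x 1 = xs →
          (∀ n : ℕ, 1 ≤ n → x (n + 1) = if Δ ∣ n then f (x n) + γ else f (x n)) →
          ∀ n : ℕ, 1 ≤ n → x (n + Δ) = x n := by
  have hpi := Real.pi_lt_d2
  refine ⟨by linarith, ?_⟩
  have hcont : Continuous f := by
    rw [funext hf]
    fun_prop
  have hFcont : Continuous F := by
    rw [funext hF]
    exact (hcont.iterate Δ).add continuous_const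
  have hlin : ∀ y, |f y - 7 / 10 * y| ≤ (1 - 7 / 10) * (4 + 2 * Real.pi) := by
    intro y
    have h₁ := Real.arctan_lt_pi_div_two (15 * y)
    have h₂ := Real.neg_pi_div_two_lt_arctan (15 * y)
    rw [hf, abs_le]
    constructor <;> linarith
  have hmaps : Set.MapsTo F (Set.Icc (-11) 11) (Set.Icc (-11) 11) := by
    rintro y ⟨hy₁, hy₂⟩
    have hit := abs_le.mp (abs_iterate_sub_pow_mul_le (by norm_num) hlin Δ y)
    have hq : (0 : ℝ) ≤ (7 / 10) ^ Δ := by positivity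
    have h₁ := mul_le_mul_of_nonneg_left hy₁ hq
    have h₂ := mul_le_mul_of_nonneg_left hy₂ hq
    rw [hF]
    constructor <;> linarith [hit.1, hit.2]
  obtain ⟨xs, hxs, hfix⟩ :=
    exists_mem_Icc_isFixedPt_of_mapsTo hFcont.continuousOn (by norm_num) hmaps
  refine ⟨xs, hxs, hfix, ?_⟩
  rintro x rfl hx
  exact impulsed_orbit_periodic hΔ ((hF _).symm.trans hfix) hx
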